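/- For 1 ≤ t ≤ (q+1)/(2e) and 0 ≤ j ≤ 2t−1, let μ̃_j be the number of nonzero a = (a_1, …, a_t) ∈ (F_{q²})^t for which the codeword c̃(a) of C^(2) has Hamming weight w̃_j = ((p−1)/p)·(q² − (je−1)q). Then for every integer i with 0 ≤ i ≤ 2t−1, Σ_{j=0}^{2t−1} (jeq − q − 1)^i · μ̃_j = q^{2t}·N_i − (q² − 1)^i, where N_0 = 1, N_1 = 0, and for i ≥ 2, N_i = i!·e^i·Σ_λ C((q+1)/e, L)·L!·Π_{j≥2} (B_j/j!)^{λ_j}/(λ_j)!, the sum being over all tuples of nonnegative integers λ = (λ_2, λ_3, …) with Σ_{j≥2} j·λ_j = i, L = Σ_{j≥2} λ_j and B_j = q^{−1}(q−1)^j + (−1)^j(1 − q^{−1}). Equivalently, the frequency vector μ̃ = (μ̃_0, …, μ̃_{2t−1})^T equals (M_t^{(2)})^{−1} b̃, where M_t^{(2)} is the 2t×2t Vandermonde matrix with (i,j) entry (jeq − q − 1)^i and b̃_i = q^{2t}N_i − (q²−1)^i. -/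

import Mathlib

theorem Finset.image_eq_pi_of_card_le {A W K : Type*} [Fintype A] [DecidableEq W] [DecidableEq K]
    {q : ℕ} {S : Finset W} {V : W → Finset K} {ev : W → A → K}
    (hmem : ∀ w ∈ S, ∀ a, ev w a ∈ V w)
    (hinj : ∀ a a', (∀ w ∈ S, ev w a = ev w a') → a = a')
    (hV : ∀ w ∈ S, (V w).card ≤ q) (hA : Fintype.card A = q ^ S.card) :
    Finset.univ.image (fun a w (_ : w ∈ S) => ev w a) = S.pi V ∧
      (S.pi V).card = q ^ S.card := by
  have hinj' : Function.Injective (fun a w (_ : w ∈ S) => ev w a) := fun a a' h =>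
    hinj a a' fun w hw => congrFun (congrFun h w) hw
  have hsub : Finset.univ.image (fun a w (_ : w ∈ S) => ev w a) ⊆ S.pi V := by
    intro f hf
    obtain ⟨a, -, rfl⟩ := Finset.mem_image.1 hf
    exact Finset.mem_pi.2 fun w hw => hmem w hw a
  have hcard : (Finset.univ.image (fun a w (_ : w ∈ S) => ev w a)).card = q ^ S.card := by
    rw [Finset.card_image_of_injective _ hinj', Finset.card_univ, hA]
  have hle : (S.pi V).card ≤ q ^ S.card := by
    rw [Finset.card_pi]
    exact Finset.prod_le_pow_card _ _ _ hV
  have heq := Finset.eq_of_subset_of_card_le hsub (by rw [hcard]; exact hle)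
  exact ⟨heq, heq ▸ hcard⟩

theorem Finset.card_eq_of_joint_injective {A W K : Type*} [Fintype A] [DecidableEq W]
    [DecidableEq K] {q : ℕ} (hq : 0 < q) {S : Finset W} {V : W → Finset K} {ev : W → A → K}
    (hmem : ∀ w ∈ S, ∀ a, ev w a ∈ V w)
    (hinj : ∀ a a', (∀ w ∈ S, ev w a = ev w a') → a = a')
    (hV : ∀ w ∈ S, (V w).card ≤ q) (hA : Fintype.card A = q ^ S.card) :
    ∀ w ∈ S, (V w).card = q := by
  have h := (Finset.image_eq_pi_of_card_le hmem hinj hV hA).2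
  rw [Finset.card_pi, ← Finset.prod_const] at h
  by_contra! hne
  obtain ⟨w, hw, hwne⟩ := hne
  have hpos : ∀ w ∈ S, 0 < (V w).card := by
    intro w hw
    by_contra h0
    rw [Finset.prod_eq_zero hw (by omega), Finset.prod_const] at h
    exact (pow_pos hq _).ne h
  exact (Finset.prod_lt_prod hpos hV ⟨w, hw, lt_of_le_of_ne (hV w hw) hwne⟩).ne h

theorem Finset.sum_prod_eq_prod_sum_of_joint_injective {A W K : Type*} [Fintype A]
    [DecidableEq W] [DecidableEq K] {q : ℕ} {S : Finset W} {V : W → Finset K} {ev : W → A → K}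
    (hmem : ∀ w ∈ S, ∀ a, ev w a ∈ V w)
    (hinj : ∀ a a', (∀ w ∈ S, ev w a = ev w a') → a = a')
    (hV : ∀ w ∈ S, (V w).card ≤ q) (hA : Fintype.card A = q ^ S.card) (φ : W → K → ℚ) :
    ∑ a, ∏ w ∈ S, φ w (ev w a) = ∏ w ∈ S, ∑ v ∈ V w, φ w v := by
  rw [Finset.prod_sum, ← (Finset.image_eq_pi_of_card_le hmem hinj hV hA).1, Finset.sum_image]
  · exact Finset.sum_congr rfl fun a _ => (Finset.prod_attach S fun w => φ w (ev w a)).symm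
  · intro a _ a' _ h
    exact hinj a a' fun w hw => congrFun (congrFun h w) hw

theorem Finset.sum_pow_centered_zero_count {A W K : Type*} [Fintype A] [Fintype W] [DecidableEq W]
    [DecidableEq K] [Zero K] {q r : ℕ} (hq : 0 < q) (hr : r ≤ Fintype.card W)
    {V : W → Finset K} {ev : W → A → K} (hmem : ∀ w a, ev w a ∈ V w) (h0 : ∀ w, 0 ∈ V w)
    (hinj : ∀ S : Finset W, S.card = r → ∀ a a', (∀ w ∈ S, ev w a = ev w a') → a = a')
    (hV : ∀ w, (V w).card ≤ q) (hA : Fintype.card A = q ^ r) {i : ℕ} (hi : i ≤ r) :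
    ∑ a, (∑ w, ((if ev w a = 0 then (q : ℚ) else 0) - 1)) ^ i =
      (q : ℚ) ^ r * ∑ k ∈ Finset.piAntidiag (Finset.univ : Finset W) i,
        (Nat.multinomial Finset.univ k : ℚ) *
          ∏ w, (((q : ℚ) - 1) ^ k w / q + (-1) ^ k w * (1 - 1 / q)) := by
  have hq' : (q : ℚ) ≠ 0 := by exact_mod_cast hq.ne'
  simp only [Finset.sum_pow_eq_sum_piAntidiag]
  rw [Finset.sum_comm, Finset.mul_sum]
  refine Finset.sum_congr rfl fun k hk => ?_
  rw [← Finset.mul_sum, mul_left_comm]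
  congr 1
  rw [Finset.mem_piAntidiag] at hk
  have hsupp : (Finset.univ.filter fun w => k w ≠ 0).card ≤ r := by
    refine le_trans ?_ hi
    rw [← hk.1, Finset.card_eq_sum_ones, Finset.sum_filter]
    refine Finset.sum_le_sum fun w _ => ?_
    split_ifs <;> omega
  obtain ⟨S, hSsub, hScard⟩ := Finset.exists_superset_card_eq hsupp hr
  have hout : ∀ w ∉ S, k w = 0 := by
    intro w hw
    by_contra h
    exact hw (hSsub (by simp [h]))
  have hA' : Fintype.card A = q ^ S.card := by rw [hA, hScard]
  have hcard := Finset.card_eq_of_joint_injective hq (fun w _ => hmem w) (hinj S hScard)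
    (fun w _ => hV w) hA'
  rw [← Finset.prod_subset (Finset.subset_univ S) fun w _ hw => by simp [hout w hw]]
  have hL : ∀ a, ∏ w, ((if ev w a = 0 then (q : ℚ) else 0) - 1) ^ k w =
      ∏ w ∈ S, ((if ev w a = 0 then (q : ℚ) else 0) - 1) ^ k w := fun a =>
    (Finset.prod_subset (Finset.subset_univ S) fun w _ hw => by simp [hout w hw]).symm
  simp only [hL]
  rw [Finset.sum_prod_eq_prod_sum_of_joint_injective (fun w _ => hmem w) (hinj S hScard)
    (fun w _ => hV w) hA' fun w v => ((if v = 0 then (q : ℚ) else 0) - 1) ^ k w,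
    ← hScard, ← Finset.prod_const, ← Finset.prod_mul_distrib]
  refine Finset.prod_congr rfl fun w hw => ?_
  rw [← Finset.add_sum_erase _ _ (h0 w), Finset.sum_congr rfl fun v hv => by
    rw [if_neg (Finset.ne_of_mem_erase hv)], Finset.sum_const, Finset.card_erase_of_mem (h0 w),
    hcard w hw, nsmul_eq_mul, Nat.cast_sub hq]
  simp
  field_simp

theorem Finset.sum_multinomial_mul_prod_eq_coeff {W : Type*} [Fintype W] [DecidableEq W]
    (B : ℕ → ℚ) (i : ℕ) (f : PowerSeries ℚ)
    (hf : ∀ j ≤ i, PowerSeries.coeff j f = B j / j.factorial) :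
    ∑ k ∈ Finset.piAntidiag (Finset.univ : Finset W) i,
        (Nat.multinomial Finset.univ k : ℚ) * ∏ w, B (k w) =
      i.factorial * PowerSeries.coeff i (f ^ Fintype.card W) := by
  have hprod : f ^ Fintype.card W = ∏ _w : W, f := by simp
  rw [hprod, PowerSeries.coeff_prod, Finset.mul_sum]
  refine Finset.sum_bij' (fun k _ => Finsupp.equivFunOnFinite.symm k) (fun l _ => ⇑l) ?_ ?_ ?_ ?_ ?_
  · intro k hk
    rw [Finset.mem_piAntidiag] at hk
    simp [Finset.mem_finsuppAntidiag, hk.1]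
  · intro l hl
    rw [Finset.mem_finsuppAntidiag] at hl
    simp [Finset.mem_piAntidiag, hl.1]
  · intro k _; rfl
  · intro l _; ext; rfl
  · intro k hk
    rw [Finset.mem_piAntidiag] at hk
    have hle : ∀ w, k w ≤ i := fun w =>
      hk.1 ▸ Finset.single_le_sum (fun _ _ => Nat.zero_le _) (Finset.mem_univ w)
    have hspec := Nat.multinomial_spec Finset.univ k
    rw [hk.1] at hspec
    have hne : ∏ w, ((k w).factorial : ℚ) ≠ 0 :=
      Finset.prod_ne_zero_iff.2 fun w _ => by exact_mod_cast (k w).factorial_ne_zero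
    simp only [Finsupp.equivFunOnFinite_symm_apply_apply]
    rw [Finset.prod_congr rfl fun w _ => hf (k w) (hle w), Finset.prod_div_distrib, ← hspec]
    push_cast
    field_simp

theorem PowerSeries.coeff_sum_add_one_pow (n i : ℕ) (b : ℕ → ℚ) :
    PowerSeries.coeff i ((∑ j : Fin (i + 1),
        PowerSeries.monomial (j : ℕ) (if (j : ℕ) < 2 then 0 else b j) + 1) ^ n) =
      ∑ fl ∈ Finset.univ.filter (fun fl : Fin (i + 1) → Fin (i + 1) =>
          (∀ j : Fin (i + 1), (j : ℕ) < 2 → fl j = 0) ∧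
          ∑ j : Fin (i + 1), (j : ℕ) * (fl j : ℕ) = i),
        (n.choose (∑ j, (fl j : ℕ)) : ℚ) * ((∑ j, (fl j : ℕ)).factorial : ℚ) *
          ∏ j : Fin (i + 1), b j ^ (fl j : ℕ) / ((fl j : ℕ).factorial : ℚ) := by
  set c : Fin (i + 1) → ℚ := fun j => if (j : ℕ) < 2 then 0 else b j with hc
  have hexp : PowerSeries.coeff i ((∑ j : Fin (i + 1), PowerSeries.monomial (j : ℕ) (c j) + 1) ^ n) =
      ∑ L ∈ Finset.range (n + 1), ∑ k ∈ Finset.piAntidiag (Finset.univ : Finset (Fin (i + 1))) L,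
        (if i = ∑ j, k j * (j : ℕ) then ∏ j, c j ^ k j else 0) *
          (Nat.multinomial Finset.univ k * n.choose L : ℚ) := by
    rw [add_pow, map_sum]
    refine Finset.sum_congr rfl fun L _ => ?_
    rw [one_pow, mul_one, Finset.sum_pow_eq_sum_piAntidiag, Finset.sum_mul, map_sum]
    refine Finset.sum_congr rfl fun k _ => ?_
    simp only [PowerSeries.monomial_pow, PowerSeries.prod_monomial]
    rw [mul_comm (Nat.cast _), mul_assoc, ← Nat.cast_mul, ← map_natCast (PowerSeries.C (R := ℚ)),
      PowerSeries.coeff_mul_C, PowerSeries.coeff_monomial]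
    push_cast
    rfl
  rw [hexp, Finset.sum_sigma']
  symm
  refine Finset.sum_bij_ne_zero (fun fl _ _ => ⟨∑ j, (fl j : ℕ), fun j => (fl j : ℕ)⟩) ?_ ?_ ?_ ?_
  · intro fl hfl hne
    have : ∑ j, (fl j : ℕ) ≤ n := by
      by_contra hlt
      exact hne (by rw [Nat.choose_eq_zero_of_lt (not_le.1 hlt)]; simp)
    simp [Finset.mem_piAntidiag, this]
  · intro f1 _ _ f2 _ _ heq
    have := eq_of_heq (Sigma.mk.inj heq).2
    funext j
    exact Fin.ext (congrFun this j)
  · rintro ⟨L, k⟩ hk hne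
    simp only [Finset.mem_sigma, Finset.mem_piAntidiag] at hk
    obtain ⟨-, rfl, -⟩ := hk
    have hi : i = ∑ j, k j * (j : ℕ) := by
      by_contra h
      simp [h] at hne
    simp only [if_pos hi] at hne
    have hprod := Finset.prod_ne_zero_iff.1 (left_ne_zero_of_mul hne)
    have hsmall : ∀ j : Fin (i + 1), (j : ℕ) < 2 → k j = 0 := by
      intro j hj
      by_contra h0
      exact hprod j (Finset.mem_univ j) (by simp only [hc]; rw [if_pos hj, zero_pow h0])
    have hlt : ∀ j, k j < i + 1 := by
      intro j
      rcases Nat.eq_zero_or_pos (j : ℕ) with h0 | h0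
      · rw [hsmall j (by omega)]; omega
      · have h1 : k j * (j : ℕ) ≤ ∑ j, k j * (j : ℕ) :=
          Finset.single_le_sum (f := fun j => k j * (j : ℕ)) (fun _ _ => Nat.zero_le _)
            (Finset.mem_univ j)
        have h2 : k j ≤ k j * (j : ℕ) := Nat.le_mul_of_pos_right _ h0
        omega
    refine ⟨fun j => ⟨k j, hlt j⟩, ?_, ?_, rfl⟩
    · simp only [Finset.mem_filter, Finset.mem_univ, true_and]
      refine ⟨fun j hj => Fin.ext (by simp [hsmall j hj]), ?_⟩
      exact (Finset.sum_congr rfl fun j _ => mul_comm _ _).trans hi.symm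
    · have hL : ((n.choose (∑ j, k j) : ℕ) : ℚ) ≠ 0 :=
        right_ne_zero_of_mul (right_ne_zero_of_mul hne)
      refine mul_ne_zero (mul_ne_zero hL (by exact_mod_cast Nat.factorial_ne_zero _)) ?_
      refine Finset.prod_ne_zero_iff.2 fun j _ => div_ne_zero ?_
        (by exact_mod_cast Nat.factorial_ne_zero _)
      have := hprod j (Finset.mem_univ j)
      by_cases hj : (j : ℕ) < 2
      · simp [hsmall j hj]
      · simp only [hc] at this
        rwa [if_neg hj] at this
  · intro fl hfl hne
    simp only [Finset.mem_filter, Finset.mem_univ, true_and] at hfl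
    obtain ⟨hsmall, hi⟩ := hfl
    have hi' : i = ∑ j, (fl j : ℕ) * (j : ℕ) := 
      hi.symm.trans (Finset.sum_congr rfl fun j _ => mul_comm _ _)
    simp only [if_pos hi']
    have hcb : ∏ j, c j ^ (fl j : ℕ) = ∏ j : Fin (i + 1), b j ^ (fl j : ℕ) := by
      refine Finset.prod_congr rfl fun j _ => ?_
      by_cases hj : (j : ℕ) < 2
      · simp [hsmall j hj]
      · simp only [hc]
        rw [if_neg hj]
    have hspec := Nat.multinomial_spec Finset.univ fun j => (fl j : ℕ)
    have hne : ∏ j, ((fl j : ℕ).factorial : ℚ) ≠ 0 :=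
      Finset.prod_ne_zero_iff.2 fun w _ => by exact_mod_cast Nat.factorial_ne_zero _
    rw [hcb, Finset.prod_div_distrib, ← hspec]
    push_cast
    field_simp

/-- Grouping the exponents `k w` by their value expresses a multinomial sum through the
multiplicities `fl j` of the values `j ≥ 2`. -/
theorem Finset.sum_multinomial_mul_prod_eq_sum_multiplicities {W : Type*} [Fintype W]
    [DecidableEq W] (B : ℕ → ℚ) (hB0 : B 0 = 1) (hB1 : B 1 = 0) (i : ℕ) :
    ∑ k ∈ Finset.piAntidiag (Finset.univ : Finset W) i,
        (Nat.multinomial Finset.univ k : ℚ) * ∏ w, B (k w) =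
      i.factorial * ∑ fl ∈ Finset.univ.filter (fun fl : Fin (i + 1) → Fin (i + 1) =>
          (∀ j : Fin (i + 1), (j : ℕ) < 2 → fl j = 0) ∧
          ∑ j : Fin (i + 1), (j : ℕ) * (fl j : ℕ) = i),
        ((Fintype.card W).choose (∑ j, (fl j : ℕ)) : ℚ) * ((∑ j, (fl j : ℕ)).factorial : ℚ) *
          ∏ j : Fin (i + 1), (B j / (j : ℕ).factorial) ^ (fl j : ℕ) /
            ((fl j : ℕ).factorial : ℚ) := by
  rw [← PowerSeries.coeff_sum_add_one_pow _ _ fun j => B j / j.factorial]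
  refine Finset.sum_multinomial_mul_prod_eq_coeff B i _ fun j hj => ?_
  rw [map_add, map_sum, Finset.sum_eq_single (⟨j, Nat.lt_succ_of_le hj⟩ : Fin (i + 1))]
  · rcases j with _ | _ | j
    · simp [hB0]
    · simp [hB1, PowerSeries.coeff_one]
    · simp [PowerSeries.coeff_one]
  · intro k _ hk
    rw [PowerSeries.coeff_monomial, if_neg fun h => hk (Fin.ext h.symm)]
  · simp

/-- The evaluation `∑ⱼ (aⱼ wʲ⁺¹ + aⱼ^q w⁻ʲ)`, which decides whether a Niho-type exponential sum
vanishes on the coset attached to `w`. -/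
def nihoEval {F : Type*} [Field F] (q : ℕ) {t : ℕ} (w : Fˣ) (a : Fin t → F) : F :=
  ∑ j : Fin t, (a j * (w : F) ^ ((j : ℕ) + 1) + a j ^ q * ((w⁻¹ : Fˣ) : F) ^ (j : ℕ))

theorem nihoEval_sub {F : Type*} [Field F] {p m : ℕ} [Fact p.Prime] [CharP F p] {t : ℕ} (w : Fˣ)
    (a b : Fin t → F) :
    nihoEval (p ^ m) w (a - b) = nihoEval (p ^ m) w a - nihoEval (p ^ m) w b := by
  simp only [nihoEval, Pi.sub_apply, sub_pow_char_pow, ← Finset.sum_sub_distrib]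
  exact Finset.sum_congr rfl fun j _ => by ring

theorem nihoEval_zero {F : Type*} [Field F] {q : ℕ} (hq : q ≠ 0) {t : ℕ} (w : Fˣ) :
    nihoEval q w (0 : Fin t → F) = 0 := by
  simp [nihoEval, hq]

theorem nihoEval_pow {F : Type*} [Field F] {p m : ℕ} [Fact p.Prime] [CharP F p]
    (hF : ∀ x : F, x ^ (p ^ m) ^ 2 = x) {t : ℕ} {w : Fˣ} (hw : w ^ (p ^ m + 1) = 1)
    (a : Fin t → F) :
    nihoEval (p ^ m) w a ^ p ^ m = ((w⁻¹ : Fˣ) : F) * nihoEval (p ^ m) w a := by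
  have hwq : w ^ p ^ m = w⁻¹ := eq_inv_of_mul_eq_one_left (by rw [← pow_succ, hw])
  have hwq' : (w : F) ^ p ^ m = ((w⁻¹ : Fˣ) : F) := by rw [← hwq]; simp
  have hwi : ((w⁻¹ : Fˣ) : F) ^ p ^ m = w := by
    rw [← Units.val_pow_eq_pow_val, inv_pow, hwq, inv_inv]
  unfold nihoEval
  rw [sum_pow_char_pow p m, Finset.mul_sum]
  refine Finset.sum_congr rfl fun j _ => ?_
  have h1 : ((w⁻¹ : Fˣ) : F) * w = 1 := by simp
  rw [add_pow_char_pow, mul_pow, mul_pow, ← pow_mul (a j), ← pow_two, hF, pow_right_comm, hwq',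
    pow_right_comm _ (j : ℕ), hwi]
  linear_combination (-(a j) * w ^ (j : ℕ)) * h1

open Polynomial in
theorem card_lt_of_nihoEval_eq_zero {F : Type*} [Field F] {q : ℕ} {t : ℕ}
    {a : Fin t → F} (ha : a ≠ 0) (S : Finset Fˣ) (hS : ∀ w ∈ S, nihoEval q w a = 0) :
    S.card < 2 * t := by
  classical
  obtain ⟨j₀, hj₀⟩ := Function.ne_iff.1 ha
  set P : F[X] := ∑ j : Fin t, (C (a j) * X ^ (t + (j : ℕ)) + C (a j ^ q) * X ^ (t - 1 - (j : ℕ)))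
    with hP
  have hcoeff : P.coeff (t + j₀) = a j₀ := by
    rw [hP, finsetSum_coeff, Finset.sum_eq_single j₀]
    · have := j₀.2
      rw [coeff_add, coeff_C_mul_X_pow, coeff_C_mul_X_pow, if_pos rfl, if_neg (by omega), add_zero]
    · intro j _ hj
      have := j₀.2
      have hne : (j₀ : ℕ) ≠ j := fun h => hj (Fin.ext h.symm)
      rw [coeff_add, coeff_C_mul_X_pow, coeff_C_mul_X_pow, if_neg (by omega), if_neg (by omega),
        add_zero]
    · simp
  have hP0 : P ≠ 0 := by
    intro h
    rw [h, coeff_zero] at hcoeff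
    exact hj₀ hcoeff.symm
  have hdeg : P.natDegree ≤ 2 * t - 1 := by
    refine natDegree_sum_le_of_forall_le _ _ fun j _ => ?_
    have := j.2
    refine (natDegree_add_le _ _).trans (max_le ?_ ?_)
    · exact (natDegree_C_mul_X_pow_le _ _).trans (by omega)
    · exact (natDegree_C_mul_X_pow_le _ _).trans (by omega)
  have heval : ∀ w : Fˣ, P.eval (w : F) = (w : F) ^ (t - 1) * nihoEval q w a := by
    intro w
    rw [hP, eval_finsetSum, nihoEval, Finset.mul_sum]
    refine Finset.sum_congr rfl fun j _ => ?_
    have := j.2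
    obtain ⟨r, hr⟩ : ∃ r, t = r + j + 1 := ⟨t - j - 1, by omega⟩
    have e1 : t - 1 = r + j := by omega
    have e2 : t - 1 - (j : ℕ) = r := by omega
    have h1 : (w : F) ^ (j : ℕ) * ((w⁻¹ : Fˣ) : F) ^ (j : ℕ) = 1 := by rw [← mul_pow]; simp
    have e3 : t + (j : ℕ) = (r + j) + (j + 1) := by omega
    simp only [eval_add, eval_mul, eval_C, eval_pow, eval_X]
    rw [e2, e1, e3, pow_add _ (r + _), pow_add _ r]
    linear_combination (-(a j ^ q) * (w : F) ^ r) * h1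
  have hroots : (S.map ⟨Units.val, Units.val_injective⟩).val ⊆ P.roots := by
    intro x hx
    rw [Finset.mem_val, Finset.mem_map] at hx
    obtain ⟨w, hw, rfl⟩ := hx
    rw [mem_roots hP0, IsRoot.def]
    exact (heval w).trans (by rw [hS w hw, mul_zero])
  have := card_le_degree_of_subset_roots hroots
  rw [Finset.card_map] at this
  have := j₀.2
  omega

open Polynomial in
theorem card_pow_eq_mul_le {F : Type*} [Field F] [Fintype F] [DecidableEq F] {q : ℕ} (hq : 1 < q)
    (c : F) : (Finset.univ.filter fun v : F => v ^ q = c * v).card ≤ q := by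
  have hdeg : (X ^ q - C c * X : F[X]).natDegree = q := by compute_degree!; rw [if_neg hq.ne']; simp; all_goals exact hq.le
  have hne : (X ^ q - C c * X : F[X]) ≠ 0 := by
    intro h; rw [h, natDegree_zero] at hdeg; omega
  calc _ ≤ (X ^ q - C c * X : F[X]).natDegree := by
        refine card_le_degree_of_subset_roots fun x hx => ?_
        rw [Finset.mem_val, Finset.mem_filter] at hx
        rw [mem_roots hne, IsRoot.def]
        simp [hx.2]
    _ = q := hdeg

/-- For `y` in the subfield with `q = p ^ m` elements, the absolute trace of `y * b` factors
through the relative trace `b + b ^ q`. -/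
theorem algebraMap_trace_mul_eq_sum {F : Type*} [Field F] [Fintype F] {p m : ℕ} [Fact p.Prime]
    [Algebra (ZMod p) F] (hF : Fintype.card F = (p ^ m) ^ 2) (b : F) {y : F}
    (hy : y ^ p ^ m = y) :
    algebraMap (ZMod p) F (Algebra.trace (ZMod p) F (y * b)) =
      ∑ i ∈ Finset.range m, (y * (b + b ^ p ^ m)) ^ p ^ i := by
  have : CharP F p := charP_of_injective_algebraMap (algebraMap (ZMod p) F).injective p
  have hfin : Module.finrank (ZMod p) F = m + m := by
    have h := Module.card_eq_pow_finrank (K := ZMod p) (V := F)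
    rw [ZMod.card, hF, ← pow_mul] at h
    have := Nat.pow_right_injective (Fact.out (p := p.Prime)).two_le h
    omega
  rw [FiniteField.algebraMap_trace_eq_sum_pow, hfin, Finset.sum_range_add,
    ← Finset.sum_add_distrib, Nat.card_zmod]
  refine Finset.sum_congr rfl fun i _ => ?_
  rw [pow_add, pow_mul (y * b), ← add_pow_char_pow, mul_pow y, hy, ← mul_add]

open Polynomial in
theorem exists_trace_mul_ne_zero {F : Type*} [Field F] [Fintype F] {p m : ℕ} [Fact p.Prime]
    [Algebra (ZMod p) F] (hm : 0 < m) (hF : Fintype.card F = (p ^ m) ^ 2) {b : F}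
    (hb : b + b ^ p ^ m ≠ 0) (K : Finset F) (hK : ∀ y ∈ K, y ^ p ^ m = y)
    (hcard : p ^ m ≤ K.card) :
    ∃ y ∈ K, Algebra.trace (ZMod p) F (y * b) ≠ 0 := by
  have hp := Fact.out (p := p.Prime)
  by_contra! hall
  set β := b + b ^ p ^ m with hβ
  set P : F[X] := ∑ i ∈ Finset.range m, C (β ^ p ^ i) * X ^ p ^ i with hP
  have hcoeff : P.coeff 1 = β := by
    rw [hP, finsetSum_coeff, Finset.sum_eq_single 0]
    · simp
    · intro i _ hi
      rw [coeff_C_mul_X_pow, if_neg (Nat.one_lt_pow hi hp.one_lt).ne]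
    · simp [hm]
  have hP0 : P ≠ 0 := by
    intro h
    rw [h, coeff_zero] at hcoeff
    exact hb hcoeff.symm
  have hdeg : P.natDegree ≤ p ^ (m - 1) := by
    refine natDegree_sum_le_of_forall_le _ _ fun i hi => ?_
    rw [Finset.mem_range] at hi
    exact (natDegree_C_mul_X_pow_le _ _).trans (Nat.pow_le_pow_right hp.pos (by omega))
  have hle : K.card ≤ P.natDegree := by
    refine card_le_degree_of_subset_roots fun y hy => ?_
    rw [mem_roots hP0, IsRoot.def, hP, eval_finsetSum]
    have h := algebraMap_trace_mul_eq_sum hF b (hK y hy)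
    rw [hall y hy, map_zero, ← hβ] at h
    rw [h]
    exact Finset.sum_congr rfl fun i _ => by simp [mul_pow, mul_comm]
  have : p ^ (m - 1) < p ^ m := Nat.pow_lt_pow_right hp.one_lt (by omega)
  omega

theorem card_units_pow_eq_one {F : Type*} [Field F] [Fintype F] [DecidableEq F] {q : ℕ} (hq : 1 < q)
    (hF : Fintype.card F = q ^ 2) :
    (Finset.univ.filter fun y : Fˣ => y ^ (q - 1) = 1).card = q - 1 := by
  have h := IsCyclic.card_powMonoidHom_ker Fˣ (q - 1)
  rw [Nat.card_eq_fintype_card, Nat.card_eq_fintype_card, Fintype.card_units, hF,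
    Nat.gcd_eq_right ⟨q + 1, by obtain ⟨r, rfl⟩ := Nat.exists_eq_add_of_lt hq; simp; ring_nf; omega⟩] at h
  refine Eq.trans ?_ h
  rw [Fintype.card_subtype]
  exact congrArg Finset.card (Finset.filter_congr fun y _ => by
    rw [MonoidHom.mem_ker, powMonoidHom_apply])

theorem filter_pow_eq_self {F : Type*} [Field F] [Fintype F] [DecidableEq F] {q : ℕ} (hq : 1 < q) :
    (Finset.univ.filter fun y : F => y ^ q = y) =
      insert 0 ((Finset.univ.filter fun y : Fˣ => y ^ (q - 1) = 1).map
        ⟨Units.val, Units.val_injective⟩) := by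
  ext y
  simp only [Finset.mem_filter, Finset.mem_univ, true_and, Finset.mem_insert, Finset.mem_map,
    Function.Embedding.coeFn_mk]
  constructor
  · intro h
    by_cases hy : y = 0
    · exact Or.inl hy
    · refine Or.inr ⟨Units.mk0 y hy, Units.ext ?_, rfl⟩
      have : y ^ (q - 1) * y = 1 * y := by rw [← pow_succ, Nat.sub_add_cancel hq.le, h, one_mul]
      simpa using mul_right_cancel₀ hy this
  · rintro (rfl | ⟨u, hu, rfl⟩)
    · exact zero_pow (by omega)
    · have h1 : ((u : F)) ^ (q - 1) = 1 := by rw [← Units.val_pow_eq_pow_val, hu, Units.val_one]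
      rw [← Nat.sub_add_cancel hq.le, pow_succ, h1, one_mul]

theorem card_trace_mul_ne_zero {F : Type*} [Field F] [Fintype F] [DecidableEq F] {p m : ℕ}
    [Fact p.Prime] [Algebra (ZMod p) F] (hm : 0 < m) (hF : Fintype.card F = (p ^ m) ^ 2) (b : F) :
    p * (Finset.univ.filter fun y : Fˣ =>
        y ^ (p ^ m - 1) = 1 ∧ Algebra.trace (ZMod p) F (y * b) ≠ 0).card =
      if b + b ^ p ^ m = 0 then 0 else (p - 1) * p ^ m := by
  classical
  have hp := Fact.out (p := p.Prime)
  have : CharP F p := charP_of_injective_algebraMap (algebraMap (ZMod p) F).injective p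
  have hq : 1 < p ^ m := Nat.one_lt_pow hm.ne' hp.one_lt
  let K : AddSubgroup F :=
    { carrier := {y | y ^ p ^ m = y}
      add_mem' := fun {x y} hx hy => by
        simp only [Set.mem_ofPred_eq] at *; rw [add_pow_char_pow, hx, hy]
      zero_mem' := zero_pow (by omega)
      neg_mem' := fun {x} hx => by
        simp only [Set.mem_ofPred_eq] at *
        rw [← zero_sub, sub_pow_char_pow, hx, zero_pow (by omega)] }
  have hKmem : ∀ y, y ∈ K ↔ y ^ p ^ m = y := fun y => Iff.rfl
  have hKfin : (Finset.univ.filter fun y : F => y ^ p ^ m = y).card = p ^ m := by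
    rw [filter_pow_eq_self hq, Finset.card_insert_of_notMem (by simp), Finset.card_map,
      card_units_pow_eq_one hq hF]
    omega
  have hKcard : Nat.card K = p ^ m := by
    rw [← hKfin, Nat.card_eq_fintype_card, Fintype.card_subtype]
    exact congrArg Finset.card (Finset.filter_congr fun y _ => hKmem y)
  let f : K →+ ZMod p :=
    { toFun := fun y => Algebra.trace (ZMod p) F (y * b)
      map_zero' := by simp
      map_add' := fun x y => by simp [add_mul] }
  have hker : (Finset.univ.filter fun y : Fˣ =>
      y ^ (p ^ m - 1) = 1 ∧ Algebra.trace (ZMod p) F (y * b) ≠ 0).card + Nat.card f.ker = p ^ m := by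
    have hkercard : Nat.card f.ker = (Finset.univ.filter fun y : F =>
        y ^ p ^ m = y ∧ Algebra.trace (ZMod p) F (y * b) = 0).card := by
      rw [← Nat.card_congr (AddSubgroup.equivMapOfInjective f.ker K.subtype
        Subtype.val_injective).toEquiv.symm, Nat.card_eq_fintype_card, Fintype.card_subtype]
      refine congrArg Finset.card (Finset.filter_congr fun y _ => ?_)
      simp [AddSubgroup.mem_map, AddMonoidHom.mem_ker, f, hKmem, and_comm]
    have hunits : (Finset.univ.filter fun y : Fˣ =>
        y ^ (p ^ m - 1) = 1 ∧ Algebra.trace (ZMod p) F (y * b) ≠ 0).card =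
        ((Finset.univ.filter fun y : F => y ^ p ^ m = y).filter fun y =>
          ¬ Algebra.trace (ZMod p) F (y * b) = 0).card := by
      rw [filter_pow_eq_self hq, Finset.filter_insert, if_neg (by simp), Finset.filter_map,
        Finset.card_map, Finset.filter_filter]
      rfl
    rw [hkercard, hunits, ← Finset.filter_filter, add_comm,
      Finset.card_filter_add_card_filter_not, hKfin]
  have hindex := AddSubgroup.card_mul_index f.ker
  rw [AddSubgroup.index_ker, hKcard] at hindex
  split_ifs with hb
  · have hall : ∀ y : F, y ^ p ^ m = y → Algebra.trace (ZMod p) F (y * b) = 0 := by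
      intro y hy
      apply (algebraMap (ZMod p) F).injective
      rw [algebraMap_trace_mul_eq_sum hF b hy, hb, map_zero]
      exact Finset.sum_eq_zero fun i _ => by
        rw [mul_zero, zero_pow (pow_ne_zero _ hp.ne_zero)]
    rw [Finset.filter_false_of_mem, Finset.card_empty, mul_zero]
    rintro y - ⟨hy, hne⟩
    refine hne (hall y ?_)
    have h1 : ((y : F)) ^ (p ^ m - 1) = 1 := by rw [← Units.val_pow_eq_pow_val, hy, Units.val_one]
    rw [← Nat.sub_add_cancel hq.le, pow_succ, h1, one_mul]
  · obtain ⟨y, hy, hne⟩ := exists_trace_mul_ne_zero hm hF hb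
      (Finset.univ.filter fun y : F => y ^ p ^ m = y) (fun y hy => (Finset.mem_filter.1 hy).2)
      hKfin.ge
    have hrange : f.range = ⊤ := by
      have : Fact (Nat.card (ZMod p)).Prime := ⟨by rwa [Nat.card_zmod]⟩
      refine (f.range.eq_bot_or_eq_top_of_prime_card).resolve_left fun hbot => hne ?_
      have hmem : f ⟨y, (Finset.mem_filter.1 hy).2⟩ ∈ f.range := ⟨_, rfl⟩
      rw [hbot, AddSubgroup.mem_bot] at hmem
      exact hmem
    rw [hrange, AddSubgroup.card_top, Nat.card_zmod] at hindex
    have hmul := congrArg (p * ·) hker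
    simp only [mul_add] at hmul
    rw [mul_comm] at hindex
    rw [Nat.sub_mul, one_mul]
    omega

theorem card_trace_ne_zero_of_semilinear {F : Type*} [Field F] [Fintype F] [DecidableEq F]
    {p m Δ : ℕ} [Fact p.Prime] [Algebra (ZMod p) F] (hm : 0 < m)
    (hF : Fintype.card F = (p ^ m) ^ 2) (hΔ : Nat.gcd Δ (p ^ m - 1) = 1) (f : Fˣ → F)
    (hf : ∀ x y : Fˣ, y ^ (p ^ m - 1) = 1 → f (x * y) = (y : F) ^ Δ * f x) :
    (p ^ m - 1) * (p * (Finset.univ.filter fun x => Algebra.trace (ZMod p) F (f x) ≠ 0).card) =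
      (p - 1) * p ^ m * (Finset.univ.filter fun x => f x + f x ^ p ^ m ≠ 0).card := by
  have hp := Fact.out (p := p.Prime)
  have hq : 1 < p ^ m := Nat.one_lt_pow hm.ne' hp.one_lt
  set H : Finset Fˣ := Finset.univ.filter fun y : Fˣ => y ^ (p ^ m - 1) = 1 with hH
  have hHcard : H.card = p ^ m - 1 := card_units_pow_eq_one hq hF
  have hshift : ∀ y ∈ H, (Finset.univ.filter fun x => Algebra.trace (ZMod p) F (f x) ≠ 0).card =
      ∑ x : Fˣ, if Algebra.trace (ZMod p) F ((y ^ Δ : Fˣ) * f x) ≠ 0 then 1 else 0 := by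
    intro y hy
    rw [Finset.card_filter, ← Equiv.sum_comp (Equiv.mulRight y)]
    refine Finset.sum_congr rfl fun x _ => ?_
    rw [Equiv.coe_mulRight, hf x y (Finset.mem_filter.1 hy).2, Units.val_pow_eq_pow_val]
  have hpow : ∀ g : Fˣ → ℕ, ∑ y ∈ H, g (y ^ Δ) = ∑ y ∈ H, g y := by
    intro g
    have hmaps : ∀ y ∈ H, y ^ Δ ∈ H := by
      intro y hy
      simp only [hH, Finset.mem_filter, Finset.mem_univ, true_and] at hy ⊢
      rw [pow_right_comm, hy, one_pow]
    have hinj : Set.InjOn (fun y : Fˣ => y ^ Δ) H := by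
      intro y hy z hz hyz
      simp only [hH, Finset.coe_filter, Finset.mem_univ, true_and, Set.mem_ofPred_eq] at hy hz
      have h1 : (y / z) ^ Δ = 1 := by rw [div_pow]; exact div_eq_one.2 hyz
      have h2 : (y / z) ^ (p ^ m - 1) = 1 := by rw [div_pow, hy, hz, div_one]
      have := Nat.dvd_gcd (orderOf_dvd_of_pow_eq_one h1) (orderOf_dvd_of_pow_eq_one h2)
      rw [hΔ, Nat.dvd_one, orderOf_eq_one_iff] at this
      exact div_eq_one.1 this
    rw [← Finset.sum_image (f := g) hinj, Finset.eq_of_subset_of_card_le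
      (Finset.image_subset_iff.2 hmaps) (Finset.card_image_of_injOn hinj).ge]
  calc _ = p * ∑ y ∈ H, (Finset.univ.filter fun x => Algebra.trace (ZMod p) F (f x) ≠ 0).card := by
        rw [Finset.sum_const, hHcard, smul_eq_mul]; ring
    _ = ∑ x : Fˣ, p * (Finset.univ.filter fun y : Fˣ =>
        y ^ (p ^ m - 1) = 1 ∧ Algebra.trace (ZMod p) F (y * f x) ≠ 0).card := by
        rw [Finset.sum_congr rfl hshift, Finset.sum_comm, Finset.mul_sum]
        refine Finset.sum_congr rfl fun x _ => ?_
        rw [hpow fun y => if Algebra.trace (ZMod p) F ((y : F) * f x) ≠ 0 then 1 else 0,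
          ← Finset.card_filter, hH, Finset.filter_filter]
    _ = ∑ x : Fˣ, if f x + f x ^ p ^ m = 0 then 0 else (p - 1) * p ^ m :=
        Finset.sum_congr rfl fun x _ => card_trace_mul_ne_zero hm hF (f x)
    _ = _ := by
        rw [Finset.card_filter, Finset.mul_sum]
        refine Finset.sum_congr rfl fun x _ => ?_
        split_ifs <;> simp_all

theorem card_filter_powMonoidHom {G : Type*} [CommGroup G] [IsCyclic G] [Fintype G] (n : ℕ)
    (Q : G → Prop) :
    Nat.card {x : G // Q (x ^ n)} = (Nat.card G).gcd n *
      Nat.card {w : (powMonoidHom n : G →* G).range // Q w} := by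
  classical
  rw [← IsCyclic.card_powMonoidHom_ker G n, Nat.card_eq_fintype_card,
    Nat.card_eq_fintype_card (α := {w : (powMonoidHom n : G →* G).range // Q w}),
    Fintype.card_subtype, Fintype.card_subtype]
  have hmaps : Set.MapsTo (powMonoidHom n : G →* G).rangeRestrict
      (Finset.univ.filter fun x : G => Q (x ^ n))
      (Finset.univ.filter fun w : (powMonoidHom n : G →* G).range => Q w) := by
    intro x hx
    simpa using hx
  rw [Finset.card_eq_sum_card_fiberwise hmaps, Finset.sum_congr rfl, Finset.sum_const, smul_eq_mul,
    mul_comm]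
  intro w hw
  have hfib := MonoidHom.card_fiber_eq_of_mem_range (powMonoidHom n : G →* G).rangeRestrict
    (x := w) (y := 1) (by simpa using (powMonoidHom n : G →* G).rangeRestrict_surjective w)
    ⟨1, map_one _⟩
  rw [Finset.filter_filter]
  rw [Finset.filter_congr (q := fun x => (powMonoidHom n : G →* G).rangeRestrict x = w), hfib,
    Nat.card_eq_fintype_card, Fintype.card_subtype]
  · refine congrArg Finset.card (Finset.filter_congr fun x _ => ?_)
    rw [← MonoidHom.ker_rangeRestrict, MonoidHom.mem_ker]
  · intro x _
    refine and_iff_right_of_imp fun h => ?_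
    have : x ^ n = w := congrArg Subtype.val h
    rw [this]
    exact (Finset.mem_filter.1 hw).2

theorem sum_pow_add_pow_eq_mul_nihoEval {F : Type*} [Field F] {p m q h Δ t : ℕ} [Fact p.Prime]
    [CharP F p] (hq : q = p ^ m) (hq1 : 1 ≤ q) {x : Fˣ} (hx : x ^ (q ^ 2 - 1) = 1)
    {d : ℕ → ℕ} {s : ℕ → ℤ} {r : ℤ} (hr : ((q : ℤ) + 1) ∣ 2 * r - (Δ - h))
    (hs : ∀ j, 1 ≤ j → j ≤ t → ((q : ℤ) + 1) ∣ s j - (j * h + r))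
    (hd : ∀ j, 1 ≤ j → j ≤ t → ((q : ℤ) ^ 2 - 1) ∣ (s j * ((q : ℤ) - 1) + Δ) - d j)
    (a : Fin t → F) :
    (∑ j : Fin t, a j * (x : F) ^ d ((j : ℕ) + 1)) +
        (∑ j : Fin t, a j * (x : F) ^ d ((j : ℕ) + 1)) ^ q =
      ((x ^ (((q : ℤ) - 1) * r + Δ) : Fˣ) : F) * nihoEval q (x ^ ((q - 1) * h)) a := by
  have hxz : x ^ ((q : ℤ) ^ 2 - 1) = 1 := by
    have h1 : ((q : ℤ) ^ 2 - 1) = ((q ^ 2 - 1 : ℕ) : ℤ) := by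
      rw [Nat.cast_sub (Nat.one_le_pow _ _ hq1)]; push_cast; ring
    rw [h1, zpow_natCast, hx]
  have hz : ∀ k l : ℤ, ((q : ℤ) ^ 2 - 1) ∣ k - l → x ^ k = x ^ l := by
    rintro k l ⟨y, hy⟩
    rw [← sub_add_cancel k l, hy, zpow_add, zpow_mul, hxz, one_zpow, one_mul]
  set u : Fˣ := x ^ (((q : ℤ) - 1) * r + Δ) with hu
  set w : Fˣ := x ^ ((q - 1) * h) with hw
  have hwz : w = x ^ (((q : ℤ) - 1) * h) := by
    rw [hw, ← zpow_natCast]; push_cast [Nat.cast_sub hq1]; rfl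
  have hxd : ∀ j : Fin t, x ^ d ((j : ℕ) + 1) = u * w ^ ((j : ℕ) + 1) := by
    intro j
    have hj := j.2
    obtain ⟨k, hk⟩ := hs (j + 1) (by omega) (by omega)
    obtain ⟨l, hl⟩ := hd (j + 1) (by omega) (by omega)
    rw [← zpow_natCast, ← zpow_natCast w, hwz, hu, ← zpow_mul, ← zpow_add]
    refine hz _ _ ⟨k - l, ?_⟩
    push_cast at hk hl ⊢
    linear_combination (-1 : ℤ) * hl + ((q : ℤ) - 1) * hk
  have huq : u ^ q = u * w := by
    obtain ⟨k, hk⟩ := hr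
    rw [← zpow_natCast, hwz, hu, ← zpow_mul, ← zpow_add]
    refine hz _ _ ⟨r - k, ?_⟩
    linear_combination (-((q : ℤ) - 1)) * hk
  have hwq : w ^ q = w⁻¹ := by
    refine eq_inv_of_mul_eq_one_left ?_
    rw [← pow_succ, ← zpow_natCast, hwz, ← zpow_mul, ← zpow_zero x]
    refine hz _ _ ⟨h, ?_⟩
    push_cast; ring
  have huq' : (u : F) ^ q = u * w := by exact_mod_cast congrArg Units.val huq
  have hwq' : (w : F) ^ q = ((w⁻¹ : Fˣ) : F) := by
    rw [← hwq]; simp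
  have hxd' : ∀ j : Fin t, (x : F) ^ d ((j : ℕ) + 1) = u * (w : F) ^ ((j : ℕ) + 1) := fun j => by
    exact_mod_cast congrArg Units.val (hxd j)
  simp only [hxd']
  have hsum : (∑ j : Fin t, a j * ((u : F) * (w : F) ^ ((j : ℕ) + 1))) ^ q =
      ∑ j : Fin t, (a j * ((u : F) * (w : F) ^ ((j : ℕ) + 1))) ^ q := by
    rw [hq]; exact sum_pow_char_pow p m _ _
  rw [hsum, ← Finset.sum_add_distrib, nihoEval, Finset.mul_sum]
  refine Finset.sum_congr rfl fun j _ => ?_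
  have h1 : (w : F) * ((w⁻¹ : Fˣ) : F) = 1 := by simp
  rw [mul_pow, mul_pow, huq', pow_right_comm, hwq', pow_succ ((w⁻¹ : Fˣ) : F)]
  linear_combination (a j ^ q * u * ((w⁻¹ : Fˣ) : F) ^ (j : ℕ)) * h1

theorem exists_common_shift {p q h Δ t : ℕ} {m : ℕ} (hm : 0 < m) (hq : q = p ^ m)
    (ht1 : 1 ≤ t) {s : ℕ → ℤ}
    (hs : ∀ j, 1 ≤ j → j ≤ t →
      2 * s j ≡ 2 * (j : ℤ) * h + ((Δ : ℤ) - h)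
        [ZMOD (if p = 2 then (q : ℤ) + 1 else 2 * ((q : ℤ) + 1))]) :
    ∃ r : ℤ, ((q : ℤ) + 1) ∣ 2 * r - (Δ - h) ∧
      ∀ j, 1 ≤ j → j ≤ t → ((q : ℤ) + 1) ∣ s j - (j * h + r) := by
  have hdvd : ((q : ℤ) + 1) ∣ (if p = 2 then (q : ℤ) + 1 else 2 * ((q : ℤ) + 1)) := by
    split_ifs
    · exact dvd_rfl
    · exact Dvd.intro_left _ rfl
  refine ⟨s 1 - h, ?_, fun j hj1 hjt => ?_⟩
  · obtain ⟨k, hk⟩ := hdvd.trans (hs 1 le_rfl ht1).symm.dvd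
    push_cast at hk
    exact ⟨k, by linear_combination hk⟩
  · have hdiff := dvd_sub (hs j hj1 hjt).symm.dvd (hs 1 le_rfl ht1).symm.dvd
    have heq : 2 * s j - (2 * (j : ℤ) * h + ((Δ : ℤ) - h)) -
        (2 * s 1 - (2 * ((1 : ℕ) : ℤ) * h + ((Δ : ℤ) - h))) = 2 * (s j - (j * h + (s 1 - h))) := by
      push_cast; ring
    rw [heq] at hdiff
    split_ifs at hdiff with hp2
    · refine IsCoprime.dvd_of_dvd_mul_left ?_ hdiff
      have heven : Even (q : ℤ) := by
        rw [hq, hp2]; push_cast; exact (even_two).pow_of_ne_zero hm.ne'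
      obtain ⟨k, hk⟩ := heven
      exact ⟨1, -k, by rw [hk]; ring⟩
    · exact (mul_dvd_mul_iff_left two_ne_zero).1 hdiff

theorem hammingNorm_eq_card_units {F : Type*} [Field F] [Fintype F] [DecidableEq F]
    {R : Type*} [Zero R] [DecidableEq R] {n : ℕ} (hn : Fintype.card Fˣ = n) {γ : Fˣ}
    (hγ : ∀ x : Fˣ, x ∈ Subgroup.zpowers γ) (g : Fˣ → R) (c : Fin n → R)
    (hc : ∀ i, c i = g (γ ^ (i : ℕ))) :
    hammingNorm c = (Finset.univ.filter fun x => g x ≠ 0).card := by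
  have horder : orderOf γ = n := by
    rw [orderOf_eq_card_of_forall_mem_zpowers hγ, Nat.card_eq_fintype_card, hn]
  have hinj : Function.Injective fun i : Fin n => γ ^ (i : ℕ) := fun i j hij =>
    Fin.ext (pow_injOn_Iio_orderOf (by simp [horder]) (by simp [horder]) hij)
  have hbij : Function.Bijective fun i : Fin n => γ ^ (i : ℕ) :=
    (Fintype.bijective_iff_injective_and_card _).2 ⟨hinj, by simp [hn]⟩
  rw [hammingNorm]
  refine Finset.card_bij (fun i _ => γ ^ (i : ℕ)) ?_ (fun i _ j _ hij => hinj hij) ?_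
  · intro i hi
    simpa [hc] using hi
  · intro x hx
    obtain ⟨i, rfl⟩ := hbij.2 x
    exact ⟨i, by simpa [hc] using hx, rfl⟩

theorem gcd_sq_sub_one_mul (q h : ℕ) :
    (q ^ 2 - 1).gcd ((q - 1) * h) = (q - 1) * h.gcd (q + 1) := by
  have hfac : q ^ 2 - 1 = (q - 1) * (q + 1) := by
    rw [mul_comm, ← Nat.sq_sub_sq, one_pow]
  rw [hfac, Nat.gcd_mul_left, Nat.gcd_comm]

theorem hammingNorm_trace_niho {F : Type*} [Field F] [Fintype F] {p m q h Δ e t : ℕ} [Fact p.Prime]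
    [Algebra (ZMod p) F] (hm : 0 < m) (hq : q = p ^ m) (hF : Fintype.card F = q ^ 2) {γ : Fˣ}
    (hγ : ∀ x : Fˣ, x ∈ Subgroup.zpowers γ) (hΔ : Nat.gcd Δ (q - 1) = 1)
    (he : e = Nat.gcd h (q + 1)) {d : ℕ → ℕ} {s : ℕ → ℤ} {r : ℤ}
    (hr : ((q : ℤ) + 1) ∣ 2 * r - (Δ - h))
    (hs : ∀ j, 1 ≤ j → j ≤ t → ((q : ℤ) + 1) ∣ s j - (j * h + r))
    (hd : ∀ j, 1 ≤ j → j ≤ t → ((q : ℤ) ^ 2 - 1) ∣ (s j * ((q : ℤ) - 1) + Δ) - d j)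
    (a : Fin t → F) (c : Fin (q ^ 2 - 1) → ZMod p)
    (hc : ∀ i, c i = Algebra.trace (ZMod p) F
      (∑ j : Fin t, a j * (γ : F) ^ (d ((j : ℕ) + 1) * (i : ℕ)))) :
    (p * hammingNorm c : ℤ) = ((p : ℤ) - 1) * ((q : ℤ) ^ 2 -
      ((Nat.card {w : (powMonoidHom ((q - 1) * h) : Fˣ →* Fˣ).range //
        nihoEval q (w : Fˣ) a = 0} : ℤ) * e - 1) * q) := by
  classical
  have hp := Fact.out (p := p.Prime)
  have : CharP F p := charP_of_injective_algebraMap (algebraMap (ZMod p) F).injective p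
  have hq1 : 1 < q := hq ▸ Nat.one_lt_pow hm.ne' hp.one_lt
  have hunits : Fintype.card Fˣ = q ^ 2 - 1 := by rw [Fintype.card_units, hF]
  have hx1 : ∀ x : Fˣ, x ^ (q ^ 2 - 1) = 1 := fun x => hunits ▸ pow_card_eq_one
  set f : Fˣ → F := fun x => ∑ j : Fin t, a j * (x : F) ^ d ((j : ℕ) + 1) with hf
  rw [hammingNorm_eq_card_units hunits hγ (fun x => Algebra.trace (ZMod p) F (f x)) c fun i => by
    rw [hc, hf]; simp only [Units.val_pow_eq_pow_val, ← pow_mul, mul_comm]]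
  have hsemi : ∀ x y : Fˣ, y ^ (p ^ m - 1) = 1 → f (x * y) = (y : F) ^ Δ * f x := by
    intro x y hy
    rw [← hq] at hy
    rw [hf, Finset.mul_sum]
    refine Finset.sum_congr rfl fun j _ => ?_
    have hj := j.2
    obtain ⟨l, hl⟩ := hd (j + 1) (by omega) (by omega)
    have hyz : y ^ ((q : ℤ) - 1) = 1 := by
      rw [← Nat.cast_one, ← Nat.cast_sub hq1.le, zpow_natCast, hy]
    have hyd : y ^ d ((j : ℕ) + 1) = y ^ Δ := by
      have h1 : (d ((j : ℕ) + 1) : ℤ) =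
          ((q : ℤ) - 1) * (s (j + 1) - ((q : ℤ) + 1) * l) + Δ := by
        linear_combination -hl
      rw [← zpow_natCast, h1, zpow_add, zpow_mul, hyz, one_zpow, one_mul, zpow_natCast]
    have hyd' : (y : F) ^ d ((j : ℕ) + 1) = (y : F) ^ Δ := by
      exact_mod_cast congrArg Units.val hyd
    rw [Units.val_mul, mul_pow, hyd']
    ring
  have hmain := card_trace_ne_zero_of_semilinear hm (hq ▸ hF) (hq ▸ hΔ) f hsemi
  have hzero : (Finset.univ.filter fun x => f x + f x ^ p ^ m = 0).card = ((q - 1) * e) *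
      Nat.card {w : (powMonoidHom ((q - 1) * h) : Fˣ →* Fˣ).range //
        nihoEval q (w : Fˣ) a = 0} := by
    rw [he, ← gcd_sq_sub_one_mul, ← hunits, ← Nat.card_eq_fintype_card,
      ← card_filter_powMonoidHom _ fun w => nihoEval q w a = 0, Nat.card_eq_fintype_card,
      Fintype.card_subtype]
    refine congrArg Finset.card (Finset.filter_congr fun x _ => ?_)
    rw [← hq, hf, sum_pow_add_pow_eq_mul_nihoEval hq hq1.le (hx1 x) hr hs hd a]
    exact mul_eq_zero.trans (or_iff_right (Units.ne_zero _))
  have htotal := Finset.card_filter_add_card_filter_not (s := (Finset.univ : Finset Fˣ))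
    fun x => f x + f x ^ p ^ m = 0
  rw [hzero, Finset.card_univ, hunits] at htotal
  rw [← hq] at hmain htotal
  have hq1' : ((q : ℤ) - 1) ≠ 0 := by
    have : (1 : ℤ) < q := by exact_mod_cast hq1
    omega
  have hmain' := congrArg (Nat.cast : ℕ → ℤ) hmain
  have htotal' := congrArg (Nat.cast : ℕ → ℤ) htotal
  push_cast [Nat.cast_sub hq1.le, Nat.cast_sub hp.one_le,
    Nat.cast_sub (Nat.one_le_pow 2 q (by omega))] at hmain' htotal'
  apply mul_left_cancel₀ hq1'
  linear_combination hmain' + ((p : ℤ) - 1) * q * htotal'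

theorem sum_pow_niho_zero_count {F : Type*} [Field F] [Fintype F] {p m q e t n : ℕ}
    [Fact p.Prime] [CharP F p] (hm : 0 < m) (hq : q = p ^ m) (hF : Fintype.card F = q ^ 2)
    (W : Subgroup Fˣ) [Fintype W] (hW : ∀ w ∈ W, w ^ (q + 1) = 1) (hcard : Fintype.card W = n)
    (hne : n * e = q + 1) (htn : 2 * t ≤ n) {i : ℕ} (hi : i ≤ 2 * t) :
    ∑ a : Fin t → F, ((Nat.card {w : W // nihoEval q (w : Fˣ) a = 0} : ℚ) * e * q - q - 1) ^ i =
      (q : ℚ) ^ (2 * t) * ((i.factorial : ℚ) * (e : ℚ) ^ i *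
        ∑ fl ∈ Finset.univ.filter (fun fl : Fin (i + 1) → Fin (i + 1) =>
            (∀ j : Fin (i + 1), (j : ℕ) < 2 → fl j = 0) ∧
            ∑ j : Fin (i + 1), (j : ℕ) * (fl j : ℕ) = i),
          (n.choose (∑ j, (fl j : ℕ)) : ℚ) *
            ((∑ j, (fl j : ℕ)).factorial : ℚ) *
            ∏ j : Fin (i + 1),
              ((((q : ℚ) - 1) ^ (j : ℕ) / q + (-1) ^ (j : ℕ) * (1 - 1 / q)) /
                  ((j : ℕ).factorial : ℚ)) ^ (fl j : ℕ) /
                ((fl j : ℕ).factorial : ℚ)) := by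
  classical
  have hp := Fact.out (p := p.Prime)
  have hq1 : 1 < q := hq ▸ Nat.one_lt_pow hm.ne' hp.one_lt
  have hq0 : (q : ℚ) ≠ 0 := by exact_mod_cast (by omega : q ≠ 0)
  have hfrob : ∀ x : F, x ^ (p ^ m) ^ 2 = x := fun x => by
    rw [← hq, ← hF, FiniteField.pow_card]
  have hmoment := Finset.sum_pow_centered_zero_count (A := Fin t → F) (W := W) (q := q) (r := 2 * t)
    (V := fun w => Finset.univ.filter fun v : F => v ^ q = (((w : Fˣ)⁻¹ : Fˣ) : F) * v)
    (ev := fun w a => nihoEval q (w : Fˣ) a) (by omega) (hcard ▸ htn)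
    (fun w a => by
      simp only [Finset.mem_filter, Finset.mem_univ, true_and]
      rw [hq]
      exact nihoEval_pow hfrob (hq ▸ hW w w.2) a)
    (fun w => by simp; omega)
    (fun S hS a a' heq => by
      by_contra hne
      refine (card_lt_of_nihoEval_eq_zero (q := q) (sub_ne_zero.2 hne)
        (S.map ⟨Subtype.val, Subtype.val_injective⟩) ?_).ne (by rw [Finset.card_map, hS])
      intro w hw
      obtain ⟨v, hv, rfl⟩ := Finset.mem_map.1 hw
      have := heq v hv
      rw [hq] at this ⊢
      exact (nihoEval_sub _ a a').trans (sub_eq_zero.2 this))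
    (fun w => card_pow_eq_mul_le hq1 _)
    (by rw [Fintype.card_fun, hF, Fintype.card_fin, ← pow_mul]) hi
  rw [Finset.sum_multinomial_mul_prod_eq_sum_multiplicities
    (fun j => ((q : ℚ) - 1) ^ j / q + (-1) ^ j * (1 - 1 / q)) (by field_simp; ring)
    (by field_simp; ring), hcard] at hmoment
  have hlin : ∀ a : Fin t → F,
      (Nat.card {w : W // nihoEval q (w : Fˣ) a = 0} : ℚ) * e * q - q - 1 =
        e * ∑ w : W, ((if nihoEval q (w : Fˣ) a = 0 then (q : ℚ) else 0) - 1) := by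
    intro a
    have hne' : (n : ℚ) * e = q + 1 := by exact_mod_cast hne
    rw [Finset.sum_sub_distrib, ← Finset.sum_filter, Finset.sum_const, Finset.sum_const,
      Finset.card_univ, hcard, Nat.card_eq_fintype_card, Fintype.card_subtype, nsmul_eq_mul,
      nsmul_eq_mul]
    linear_combination hne'
  simp only [hlin, mul_pow, ← Finset.mul_sum, hmoment]
  ring


open Matrix

/-- Theorem 2(ii): power-moment identities and weight distribution of the `p`-ary code
`C⁽²⁾`.  With the setup of the paper, let `μ̃_j` be the number of nonzero messages `a` whose
codeword `c̃(a)` has Hamming weight `w̃_j = ((p-1)/p)(q² - (je-1)q)`.  Then for all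
`0 ≤ i ≤ 2t-1`, `∑_{j=0}^{2t-1} (jeq - q - 1)^i μ̃_j = q^{2t} N_i - (q²-1)^i`, where
`N_0 = 1`, `N_1 = 0` and for `i ≥ 2`, `N_i` is given by the explicit formula (2.7) of the
paper; equivalently `μ̃ = (M_t^{(2)})⁻¹ b̃` with `M_t^{(2)}` the `2t × 2t` Vandermonde
matrix with entries `(jeq-q-1)^i` and `b̃_i = q^{2t} N_i - (q²-1)^i`. -/
theorem stmt_17 (p m : ℕ) (hp : p.Prime) (hm : 0 < m) (q : ℕ) (hq : q = p ^ m)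
    (F : Type*) [Field F] [Fintype F] [Algebra (ZMod p) F]
    (hF : Fintype.card F = q ^ 2)
    (γ : Fˣ) (hγ : ∀ x : Fˣ, x ∈ Subgroup.zpowers γ)
    (h Δ : ℕ) (hh : 0 < h) (hΔpos : 0 < Δ)
    (hhq : ¬ (q + 1) ∣ h) (hΔ : Nat.gcd Δ (q - 1) = 1)
    (hparity : p ≠ 2 → Odd Δ ∧ Odd h)
    (e : ℕ) (he : e = Nat.gcd h (q + 1))
    (t : ℕ) (ht1 : 1 ≤ t) (ht : 2 * e * t ≤ q + 1)
    (d : ℕ → ℕ) (s : ℕ → ℤ)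
    (hdpos : ∀ j, 1 ≤ j → j ≤ t → 0 < d j)
    (hs : ∀ j, 1 ≤ j → j ≤ t →
      2 * s j ≡ 2 * (j : ℤ) * h + ((Δ : ℤ) - h)
        [ZMOD (if p = 2 then (q : ℤ) + 1 else 2 * ((q : ℤ) + 1))])
    (hd : ∀ j, 1 ≤ j → j ≤ t →
      (d j : ℤ) ≡ s j * ((q : ℤ) - 1) + Δ [ZMOD ((q : ℤ) ^ 2 - 1)])
    (c : (Fin t → F) → Fin (q ^ 2 - 1) → ZMod p)
    (hc : ∀ a i, c a i =
      Algebra.trace (ZMod p) F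
        (∑ j : Fin t, a j * (γ : F) ^ (d ((j : ℕ) + 1) * (i : ℕ))))
    (μ : ℕ → ℕ)
    (hμ : ∀ j, μ j = Nat.card {a : Fin t → F // a ≠ 0 ∧
      (p * hammingNorm (c a) : ℤ) =
        ((p : ℤ) - 1) * ((q : ℤ) ^ 2 - ((j : ℤ) * e - 1) * q)})
    (N : ℕ → ℚ) (hN0 : N 0 = 1) (hN1 : N 1 = 0)
    (hN : ∀ i, 2 ≤ i → N i =
      (i.factorial : ℚ) * (e : ℚ) ^ i *
        ∑ fl ∈ Finset.univ.filter (fun fl : Fin (i + 1) → Fin (i + 1) =>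
            (∀ j : Fin (i + 1), (j : ℕ) < 2 → fl j = 0) ∧
            ∑ j : Fin (i + 1), (j : ℕ) * (fl j : ℕ) = i),
          (((q + 1) / e).choose (∑ j, (fl j : ℕ)) : ℚ) *
            ((∑ j, (fl j : ℕ)).factorial : ℚ) *
            ∏ j : Fin (i + 1),
              ((((q : ℚ) - 1) ^ (j : ℕ) / q + (-1) ^ (j : ℕ) * (1 - 1 / q)) /
                  ((j : ℕ).factorial : ℚ)) ^ (fl j : ℕ) /
                ((fl j : ℕ).factorial : ℚ)) :
    (∀ i ≤ 2 * t - 1,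
      ∑ j ∈ Finset.range (2 * t),
        ((j : ℚ) * e * q - q - 1) ^ i * (μ j : ℚ) =
          (q : ℚ) ^ (2 * t) * N i - ((q : ℚ) ^ 2 - 1) ^ i) ∧
    (fun j : Fin (2 * t) => (μ (j : ℕ) : ℚ)) =
      (Matrix.of fun i j : Fin (2 * t) =>
          ((j : ℚ) * e * q - q - 1) ^ (i : ℕ))⁻¹ *ᵥ
        (fun i : Fin (2 * t) =>
          (q : ℚ) ^ (2 * t) * N (i : ℕ) - ((q : ℚ) ^ 2 - 1) ^ (i : ℕ)) := by
  classical
  have : Fact p.Prime := ⟨hp⟩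
  have : CharP F p := charP_of_injective_algebraMap (algebraMap (ZMod p) F).injective p
  have hq1 : 1 < q := hq ▸ Nat.one_lt_pow hm.ne' hp.one_lt
  have hunits : Nat.card Fˣ = q ^ 2 - 1 := by
    rw [Nat.card_eq_fintype_card, Fintype.card_units, hF]
  obtain ⟨r, hr, hsr⟩ := exists_common_shift hm hq ht1 hs
  have hdr : ∀ j, 1 ≤ j → j ≤ t → ((q : ℤ) ^ 2 - 1) ∣ (s j * ((q : ℤ) - 1) + Δ) - d j :=
    fun j hj1 hjt => (hd j hj1 hjt).dvd
  have he0 : 0 < e := he ▸ Nat.gcd_pos_of_pos_left _ hh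
  have hne : (q + 1) / e * e = q + 1 := Nat.div_mul_cancel (he ▸ Nat.gcd_dvd_right _ _)
  have htn : 2 * t ≤ (q + 1) / e := by
    rw [Nat.le_div_iff_mul_le he0]
    linarith
  set W : Subgroup Fˣ := (powMonoidHom ((q - 1) * h) : Fˣ →* Fˣ).range with hWdef
  have hfac : q ^ 2 - 1 = (q - 1) * (q + 1) := by
    rw [mul_comm, ← Nat.sq_sub_sq, one_pow]
  have hW : ∀ w ∈ W, w ^ (q + 1) = 1 := by
    rintro _ ⟨x, rfl⟩
    rw [powMonoidHom_apply, ← pow_mul, mul_right_comm, ← hfac, ← hunits, pow_mul, pow_card_eq_one',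
      one_pow]
  have hWcard : Fintype.card W = (q + 1) / e := by
    rw [← Nat.card_eq_fintype_card, hWdef, IsCyclic.card_powMonoidHom_range, hunits,
      gcd_sq_sub_one_mul, ← he, hfac, Nat.mul_div_mul_left _ _ (by omega)]
  set Z : (Fin t → F) → ℕ := fun a => Nat.card {w : W // nihoEval q (w : Fˣ) a = 0} with hZ
  have hμZ : ∀ j, μ j = (Finset.univ.filter fun a : Fin t → F => a ≠ 0 ∧ Z a = j).card := by
    intro j
    rw [hμ, Nat.card_eq_fintype_card, Fintype.card_subtype]
    refine congrArg Finset.card (Finset.filter_congr fun a _ => and_congr_right fun _ => ?_)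
    rw [hammingNorm_trace_niho hm hq hF hγ hΔ he hr hsr hdr a (c a) (hc a)]
    have hp1 : ((p : ℤ) - 1) ≠ 0 := by
      have : (1 : ℤ) < p := by exact_mod_cast hp.one_lt
      omega
    have hq0 : (q : ℤ) ≠ 0 := by omega
    have he0' : (e : ℤ) ≠ 0 := by omega
    rw [mul_right_inj' hp1, sub_right_inj, mul_left_inj' hq0, sub_left_inj, mul_left_inj' he0',
      Nat.cast_inj]
  have hZlt : ∀ a : Fin t → F, a ≠ 0 → Z a < 2 * t := by
    intro a ha
    have := card_lt_of_nihoEval_eq_zero (q := q) ha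
      ((Finset.univ.filter fun w : W => nihoEval q (w : Fˣ) a = 0).map
        ⟨Subtype.val, Subtype.val_injective⟩) (by
          intro w hw
          obtain ⟨v, hv, rfl⟩ := Finset.mem_map.1 hw
          exact (Finset.mem_filter.1 hv).2)
    rwa [Finset.card_map, ← Fintype.card_subtype, ← Nat.card_eq_fintype_card] at this
  have hZ0 : Z 0 = (q + 1) / e := by
    rw [hZ, ← hWcard, ← Nat.card_eq_fintype_card]
    exact Nat.card_congr (Equiv.subtypeUnivEquiv fun w => nihoEval_zero (by omega) _)
  have hNall : ∀ i, N i = (i.factorial : ℚ) * (e : ℚ) ^ i *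
        ∑ fl ∈ Finset.univ.filter (fun fl : Fin (i + 1) → Fin (i + 1) =>
            (∀ j : Fin (i + 1), (j : ℕ) < 2 → fl j = 0) ∧
            ∑ j : Fin (i + 1), (j : ℕ) * (fl j : ℕ) = i),
          (((q + 1) / e).choose (∑ j, (fl j : ℕ)) : ℚ) *
            ((∑ j, (fl j : ℕ)).factorial : ℚ) *
            ∏ j : Fin (i + 1),
              ((((q : ℚ) - 1) ^ (j : ℕ) / q + (-1) ^ (j : ℕ) * (1 - 1 / q)) /
                  ((j : ℕ).factorial : ℚ)) ^ (fl j : ℕ) /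
                ((fl j : ℕ).factorial : ℚ) := by
    rintro (_ | _ | i)
    · rw [hN0, Finset.sum_eq_single (fun _ => 0)]
      · simp
      · intro b _ hb
        exact absurd (funext fun x => Fin.ext (by omega)) hb
      · simp
    · rw [hN1, Finset.sum_eq_zero, mul_zero]
      intro fl hfl
      obtain ⟨hsmall, hsum⟩ := (Finset.mem_filter.1 hfl).2
      rw [Finset.sum_eq_zero fun j _ => by rw [hsmall j (by omega)]; simp] at hsum
      omega
    · exact hN (i + 2) (by omega)
  have hmoment : ∀ i ≤ 2 * t - 1, ∑ j ∈ Finset.range (2 * t),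
      ((j : ℚ) * e * q - q - 1) ^ i * (μ j : ℚ) =
        (q : ℚ) ^ (2 * t) * N i - ((q : ℚ) ^ 2 - 1) ^ i := by
    intro i hi
    have htotal := sum_pow_niho_zero_count hm hq hF W hW hWcard hne htn (i := i) (by omega)
    rw [← hNall, ← Finset.add_sum_erase _ _ (Finset.mem_univ (0 : Fin t → F))] at htotal
    change ((Z 0 : ℚ) * e * q - q - 1) ^ i +
      ∑ a ∈ Finset.univ.erase (0 : Fin t → F), ((Z a : ℚ) * e * q - q - 1) ^ i = _ at htotal
    have hne' : (((q + 1) / e : ℕ) : ℚ) * e = q + 1 := by exact_mod_cast hne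
    have hzero : (Z 0 : ℚ) * e * q - q - 1 = (q : ℚ) ^ 2 - 1 := by
      rw [hZ0, hne']; ring
    rw [hzero] at htotal
    rw [eq_sub_iff_add_eq', ← htotal, ← Finset.sum_fiberwise_of_maps_to (g := Z)
      (t := Finset.range (2 * t)) fun a ha => Finset.mem_range.2 (hZlt a (Finset.ne_of_mem_erase ha))]
    congr 1
    refine Finset.sum_congr rfl fun j _ => ?_
    rw [Finset.sum_congr rfl fun a ha => by rw [(Finset.mem_filter.1 ha).2], Finset.sum_const,
      nsmul_eq_mul, mul_comm, hμZ]
    congr 3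
    ext a
    simp
  refine ⟨hmoment, ?_⟩
  set M : Matrix (Fin (2 * t)) (Fin (2 * t)) ℚ :=
    Matrix.of fun i j : Fin (2 * t) => ((j : ℚ) * e * q - q - 1) ^ (i : ℕ) with hM
  have hdet : IsUnit M.det := by
    have hMv : M = (Matrix.vandermonde fun j : Fin (2 * t) => (j : ℚ) * e * q - q - 1)ᵀ := by
      ext i j
      rfl
    rw [hMv, Matrix.det_transpose, isUnit_iff_ne_zero, Matrix.det_vandermonde_ne_zero_iff]
    intro i j hij
    have he0' : (e : ℚ) ≠ 0 := by exact_mod_cast he0.ne'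
    have hq0' : (q : ℚ) ≠ 0 := by exact_mod_cast (by omega : q ≠ 0)
    have : ((i : ℕ) : ℚ) = ((j : ℕ) : ℚ) := by
      apply mul_right_cancel₀ he0'
      apply mul_right_cancel₀ hq0'
      simpa using hij
    exact Fin.ext (by exact_mod_cast this)
  have hmul : (fun i : Fin (2 * t) =>
      (q : ℚ) ^ (2 * t) * N (i : ℕ) - ((q : ℚ) ^ 2 - 1) ^ (i : ℕ)) =
        M *ᵥ fun j : Fin (2 * t) => (μ (j : ℕ) : ℚ) := by
    funext i
    rw [← hmoment i (by omega), Finset.sum_range]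
    rfl
  rw [hmul, Matrix.mulVec_mulVec, Matrix.nonsing_inv_mul _ hdet, Matrix.one_mulVec]
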